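/- Let G be a group. There exists a G-boundary ∂G that is universal in the following sense: for every G-boundary Y there exists a continuous G-equivariant surjection ∂G → Y. -/

import Mathlib

open MeasureTheory

/-- The Dirac probability measure at a point. -/
noncomputable def diracProb {X : Type*} [MeasurableSpace X] (x : X) :
    ProbabilityMeasure X :=
  ⟨Measure.dirac x, inferInstance⟩

/-- The pushforward action of a group element on probability measures:
`(g • μ)(E) = μ (g⁻¹ • E)`. -/
noncomputable def pushforwardProb {G X : Type*} [Group G] [TopologicalSpace X]
    [MeasurableSpace X] [BorelSpace X] [MulAction G X] [ContinuousConstSMul G X]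
    (g : G) (μ : ProbabilityMeasure X) : ProbabilityMeasure X :=
  μ.map (f := fun x => g • x) ((continuous_const_smul g).measurable.aemeasurable)

/-- The action of `G` on `X` is minimal if every orbit is dense. -/
def IsMinimalAction (G X : Type*) [Group G] [TopologicalSpace X] [MulAction G X] : Prop :=
  ∀ x : X, Dense (MulAction.orbit G x)

/-- The action of `G` on `X` is strongly proximal if the weak-* closure of the orbit of every
probability measure on `X` contains a Dirac measure. -/
def IsStronglyProximal (G X : Type*) [Group G] [TopologicalSpace X] [MeasurableSpace X]
    [BorelSpace X] [MulAction G X] [ContinuousConstSMul G X] : Prop :=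
  ∀ μ : ProbabilityMeasure X, ∃ x : X,
    diracProb x ∈ closure {ν | ∃ g : G, ν = pushforwardProb g μ}

universe u

/-- A `G`-boundary: a nonempty compact Hausdorff `G`-space (with its Borel σ-algebra) on which
the action of `G` is minimal and strongly proximal. -/
structure GBoundary (G : Type u) [Group G] where
  (carrier : Type u)
  [topo : TopologicalSpace carrier]
  [meas : MeasurableSpace carrier]
  [action : MulAction G carrier]
  [cpt : CompactSpace carrier]
  [t2 : T2Space carrier]
  [nonempty : Nonempty carrier]
  [borel : BorelSpace carrier]
  [contSMul : ContinuousConstSMul G carrier]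
  (minimal : IsMinimalAction G carrier)
  (stronglyProximal : IsStronglyProximal G carrier)

attribute [instance] GBoundary.topo GBoundary.meas GBoundary.action GBoundary.cpt
  GBoundary.t2 GBoundary.nonempty GBoundary.borel GBoundary.contSMul

open Topology Filter Set

section Minimal

/-- A nonempty compact closed set that is invariant under a family of self-maps contains a minimal
nonempty closed invariant subset. -/
theorem exists_minimal_closed_invariant {ι α : Type*} [TopologicalSpace α] (T : ι → α → α)
    {S : Set α} (hS : IsCompact S) (hSc : IsClosed S) (hne : S.Nonempty)
    (hinv : ∀ i, MapsTo (T i) S S) :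
    ∃ M ⊆ S, IsClosed M ∧ M.Nonempty ∧ (∀ i, MapsTo (T i) M M) ∧
      ∀ N ⊆ M, IsClosed N → N.Nonempty → (∀ i, MapsTo (T i) N N) → N = M := by
  let 𝒮 : Set (Set α) := {M | M ⊆ S ∧ IsClosed M ∧ M.Nonempty ∧ ∀ i, MapsTo (T i) M M}
  obtain ⟨M, -, hM⟩ := zorn_superset_nonempty 𝒮 (fun c hc hchain hcne => by
    refine ⟨⋂₀ c, ⟨?_, ?_, ?_, ?_⟩, fun s hs => sInter_subset_of_mem hs⟩
    · obtain ⟨s, hs⟩ := hcne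
      exact (sInter_subset_of_mem hs).trans (hc hs).1
    · exact isClosed_sInter fun s hs => (hc hs).2.1
    · have : Nonempty c := hcne.to_subtype
      exact IsCompact.nonempty_sInter_of_directed_nonempty_isCompact_isClosed
        (fun s hs t ht => (hchain.total hs ht).elim (fun h => ⟨s, hs, Subset.rfl, h⟩)
          fun h => ⟨t, ht, h, Subset.rfl⟩) (fun s hs => (hc hs).2.2.1)
        (fun s hs => hS.of_isClosed_subset (hc hs).2.1 (hc hs).1) (fun s hs => (hc hs).2.1)
    · exact fun i x hx s hs => (hc hs).2.2.2 i (hx s hs)) S ⟨Subset.rfl, hSc, hne, hinv⟩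
  refine ⟨M, hM.prop.1, hM.prop.2.1, hM.prop.2.2.1, hM.prop.2.2.2, fun N hN hNc hNne hNi => ?_⟩
  exact hN.antisymm (hM.le_of_le ⟨hN.trans hM.prop.1, hNc, hNne, hNi⟩ hN)

end Minimal

section States

variable {X Y Z : Type*} [TopologicalSpace X] [TopologicalSpace Y] [TopologicalSpace Z]

/-- The states on `C(X, ℝ)`, as a set of functions on `C(X, ℝ)`. The ambient product topology
induces the weak-* topology. -/
def stateSpace (X : Type*) [TopologicalSpace X] : Set (C(X, ℝ) → ℝ) :=
  {φ | (∀ f g, φ (f + g) = φ f + φ g) ∧ (∀ (c : ℝ) f, φ (c • f) = c * φ f) ∧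
    (∀ f, 0 ≤ f → 0 ≤ φ f) ∧ φ 1 = 1}

/-- Evaluation at a point, as a functional on `C(X, ℝ)`. -/
def evalState (x : X) : C(X, ℝ) → ℝ := fun f => f x

/-- The pushforward of a functional on `C(X, ℝ)` along a continuous map. -/
def pushState (p : C(X, Y)) (φ : C(X, ℝ) → ℝ) : C(Y, ℝ) → ℝ := fun f => φ (f.comp p)

theorem continuous_evalState : Continuous (evalState : X → C(X, ℝ) → ℝ) :=
  continuous_pi fun f => f.continuous

theorem continuous_pushState (p : C(X, Y)) : Continuous (pushState p) :=
  continuous_pi fun f => continuous_apply (f.comp p)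

theorem pushState_evalState (p : C(X, Y)) (x : X) :
    pushState p (evalState x) = evalState (p x) := rfl

theorem pushState_comp (q : C(Y, Z)) (p : C(X, Y)) (φ : C(X, ℝ) → ℝ) :
    pushState (q.comp p) φ = pushState q (pushState p φ) := rfl

theorem pushState_mem_stateSpace (p : C(X, Y)) {φ : C(X, ℝ) → ℝ} (hφ : φ ∈ stateSpace X) :
    pushState p φ ∈ stateSpace Y :=
  ⟨fun f g => hφ.1 (f.comp p) (g.comp p), fun c f => hφ.2.1 c (f.comp p),
    fun f hf => hφ.2.2.1 (f.comp p) fun x => hf (p x), hφ.2.2.2⟩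

theorem isClosed_stateSpace : IsClosed (stateSpace X) := by
  simp only [stateSpace, ofPred_and, ofPred_forall]
  refine .inter ?_ (.inter ?_ (.inter ?_ ?_))
  · exact isClosed_iInter fun f => isClosed_iInter fun g =>
      isClosed_eq (by fun_prop) (by fun_prop)
  · exact isClosed_iInter fun f => isClosed_iInter fun g =>
      isClosed_eq (by fun_prop) (by fun_prop)
  · exact isClosed_iInter fun f => isClosed_iInter fun _ =>
      isClosed_le (by fun_prop) (by fun_prop)
  · exact isClosed_eq (by fun_prop) (by fun_prop)

namespace stateSpace

variable {φ : C(X, ℝ) → ℝ}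

/-- A state as a linear map. -/
def toLinearMap (hφ : φ ∈ stateSpace X) : C(X, ℝ) →ₗ[ℝ] ℝ where
  toFun := φ
  map_add' := hφ.1
  map_smul' := hφ.2.1

theorem map_sub (hφ : φ ∈ stateSpace X) (f g : C(X, ℝ)) : φ (f - g) = φ f - φ g :=
  _root_.map_sub (toLinearMap hφ) f g

theorem mono (hφ : φ ∈ stateSpace X) {f g : C(X, ℝ)} (h : f ≤ g) : φ f ≤ φ g := by
  have := hφ.2.2.1 (g - f) (sub_nonneg.2 h)
  rw [map_sub hφ] at this
  linarith

theorem map_neg (hφ : φ ∈ stateSpace X) (f : C(X, ℝ)) : φ (-f) = -φ f :=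
  _root_.map_neg (toLinearMap hφ) f

theorem abs_le_abs (hφ : φ ∈ stateSpace X) (f : C(X, ℝ)) : |φ f| ≤ φ |f| := by
  rw [abs_le]
  have h₁ := mono hφ (le_abs_self f)
  have h₂ := mono hφ (neg_le_abs f)
  rw [map_neg hφ] at h₂
  constructor <;> linarith

variable [CompactSpace X]

theorem abs_le_norm (hφ : φ ∈ stateSpace X) (f : C(X, ℝ)) : |φ f| ≤ ‖f‖ := by
  refine (abs_le_abs hφ f).trans ?_
  have : |f| ≤ ‖f‖ • (1 : C(X, ℝ)) := fun x => by
    simpa using f.norm_coe_le_norm x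
  refine (mono hφ this).trans ?_
  rw [hφ.2.1, hφ.2.2.2, mul_one]

protected theorem continuous (hφ : φ ∈ stateSpace X) : Continuous φ :=
  ((toLinearMap hφ).mkContinuous 1 fun f => by
    rw [one_mul]
    exact abs_le_norm hφ f).continuous

end stateSpace

theorem isCompact_stateSpace [CompactSpace X] : IsCompact (stateSpace X) := by
  refine (isCompact_univ_pi fun f : C(X, ℝ) =>
    isCompact_Icc (a := -‖f‖) (b := ‖f‖)).of_isClosed_subset
    isClosed_stateSpace fun φ hφ f _ => abs_le.1 (stateSpace.abs_le_norm hφ f)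

/-- A state whose marginal along `p` is a point evaluation is multiplicative on functions that
factor through `p`. -/
theorem stateSpace.map_comp_mul [CompactSpace X] {φ : C(X, ℝ) → ℝ} (hφ : φ ∈ stateSpace X)
    (p : C(X, Y)) {y : Y} (hy : pushState p φ = evalState y) (h : C(Y, ℝ)) (g : C(X, ℝ)) :
    φ (h.comp p * g) = φ (h.comp p) * φ g := by
  have hval : ∀ k : C(Y, ℝ), φ (k.comp p) = k y := fun k => congrFun hy k
  let k : C(Y, ℝ) := h - ContinuousMap.const Y (h y)
  have hzero : φ (k.comp p * g) = 0 := by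
    have hle : |k.comp p * g| ≤ ‖g‖ • (|k|.comp p) := fun x => by
      have := mul_le_mul_of_nonneg_left (g.norm_coe_le_norm x) (abs_nonneg (k (p x)))
      simpa [abs_mul, mul_comm] using this
    have h₁ := (stateSpace.abs_le_abs hφ _).trans (stateSpace.mono hφ hle)
    rw [hφ.2.1, hval] at h₁
    have : |k| y = 0 := by simp [k]
    rw [this, mul_zero] at h₁
    exact abs_nonpos_iff.1 h₁
  have hdecomp : h.comp p * g = k.comp p * g + h y • g := by
    ext x
    simp [k]
    ring
  rw [hdecomp, hφ.1, hφ.2.1, hzero, hval, zero_add]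

/-- A state on a compact Hausdorff space is a point evaluation as soon as its marginals along a
point-separating family of continuous maps are point evaluations. -/
theorem stateSpace.exists_eq_evalState [CompactSpace X] [T2Space X] {ι : Type*} {W : ι → Type*}
    [∀ i, TopologicalSpace (W i)] [∀ i, CompactSpace (W i)] [∀ i, T2Space (W i)]
    (p : ∀ i, C(X, W i)) (hp : ∀ x x', (∀ i, p i x = p i x') → x = x')
    {φ : C(X, ℝ) → ℝ} (hφ : φ ∈ stateSpace X)
    (h : ∀ i, ∃ y, pushState (p i) φ = evalState y) : ∃ x, φ = evalState x := by
  let A : Subalgebra ℝ C(X, ℝ) :=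
    { carrier := {f | ∀ g, φ (f * g) = φ f * φ g}
      mul_mem' := fun {a b} ha hb g => by rw [mul_assoc, ha, hb, ha, mul_assoc]
      add_mem' := fun {a b} ha hb g => by rw [add_mul, hφ.1, hφ.1, ha, hb, add_mul]
      algebraMap_mem' := fun c g => by
        rw [Algebra.algebraMap_eq_smul_one, smul_mul_assoc, one_mul, hφ.2.1, hφ.2.1, hφ.2.2.2,
          mul_one] }
  have hclosed : IsClosed (A : Set C(X, ℝ)) := by
    have hc := stateSpace.continuous hφ
    have : (A : Set C(X, ℝ)) = ⋂ g, {f | φ (f * g) = φ f * φ g} := by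
      ext f
      simp [A]
    rw [this]
    exact isClosed_iInter fun g => isClosed_eq (by fun_prop) (by fun_prop)
  have hsep : A.SeparatesPoints := fun x x' hne => by
    obtain ⟨i, hi⟩ := not_forall.1 (mt (hp x x') hne)
    obtain ⟨y, hy⟩ := h i
    obtain ⟨k, hk₀, hk₁, -⟩ := exists_continuous_zero_one_of_isClosed
      (isClosed_singleton (x := p i x)) (isClosed_singleton (x := p i x'))
      (by simpa using hi)
    refine ⟨_, ⟨k.comp (p i), stateSpace.map_comp_mul hφ (p i) hy k, rfl⟩, ?_⟩
    simp [hk₀ rfl, hk₁ rfl]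
  have htop : A = ⊤ := by
    rw [← ContinuousMap.subalgebra_topologicalClosure_eq_top_of_separatesPoints A hsep]
    exact le_antisymm A.le_topologicalClosure (A.topologicalClosure_minimal le_rfl hclosed)
  have hmul : ∀ f g, φ (f * g) = φ f * φ g := fun f =>
    show f ∈ A from htop ▸ Algebra.mem_top
  obtain ⟨x, hx⟩ := (WeakDual.CharacterSpace.continuousMapEval_bijective X ℝ).surjective
    (WeakDual.CharacterSpace.equivAlgHom.symm
      (AlgHom.ofLinearMap (stateSpace.toLinearMap hφ) hφ.2.2.2 hmul))
  exact ⟨x, funext fun f => (DFunLike.congr_fun hx f).symm⟩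

end States

section Measures

variable {X : Type*} [TopologicalSpace X] [MeasurableSpace X] [BorelSpace X]

/-- The state given by integration against a probability measure. -/
noncomputable def integralState (μ : ProbabilityMeasure X) : C(X, ℝ) → ℝ := fun f => ∫ x, f x ∂μ

theorem integralState_diracProb [T2Space X] (x : X) : integralState (diracProb x) = evalState x :=
  funext fun f => integral_dirac f x

variable [CompactSpace X]

theorem integrable_of_compactSpace (μ : ProbabilityMeasure X) (f : C(X, ℝ)) :
    Integrable f (μ : Measure X) :=
  (BoundedContinuousFunction.mkOfCompact f).integrable (μ : Measure X)

theorem integralState_mem_stateSpace (μ : ProbabilityMeasure X) :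
    integralState μ ∈ stateSpace X := by
  refine ⟨fun f g => ?_, fun c f => ?_, fun f hf => ?_, ?_⟩
  · exact integral_add (integrable_of_compactSpace μ f) (integrable_of_compactSpace μ g)
  · exact integral_const_mul c f
  · exact integral_nonneg hf
  · simp [integralState]

theorem isInducing_integralState :
    IsInducing (integralState : ProbabilityMeasure X → C(X, ℝ) → ℝ) := by
  refine isInducing_iff_nhds.2 fun μ => le_antisymm ?_ ?_
  · refine tendsto_iff_comap.1 (tendsto_pi_nhds.2 fun f => ?_)
    exact ProbabilityMeasure.tendsto_iff_forall_integral_tendsto.1 tendsto_id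
      (BoundedContinuousFunction.mkOfCompact f)
  · refine tendsto_id'.1 (ProbabilityMeasure.tendsto_iff_forall_integral_tendsto.2 fun f => ?_)
    exact tendsto_pi_nhds.1 (tendsto_comap (f := integralState) (x := 𝓝 (integralState μ)))
      f.toContinuousMap

variable [T2Space X]

/-- Every state is given by integration against a probability measure. -/
theorem exists_integralState_eq {φ : C(X, ℝ) → ℝ} (hφ : φ ∈ stateSpace X) :
    ∃ μ : ProbabilityMeasure X, integralState μ = φ := by
  let Λ : CompactlySupportedContinuousMap X ℝ →ₚ[ℝ] ℝ := PositiveLinearMap.mk₀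
    { toFun := fun f => φ f
      map_add' := fun f g => hφ.1 f g
      map_smul' := fun c f => hφ.2.1 c f } fun f hf => hφ.2.2.1 f hf
  have hΛ : ∀ f : C(X, ℝ), ∫ x, f x ∂(RealRMK.rieszMeasure Λ) = φ f := fun f =>
    RealRMK.integral_rieszMeasure Λ (CompactlySupportedContinuousMap.continuousMapEquiv f)
  have hprob : IsProbabilityMeasure (RealRMK.rieszMeasure Λ) := by
    have h₁ := hΛ 1
    rw [hφ.2.2.2] at h₁
    simp only [ContinuousMap.one_apply, integral_const, smul_eq_mul, mul_one] at h₁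
    exact isProbabilityMeasure_iff_real.2 h₁
  exact ⟨⟨_, hprob⟩, funext hΛ⟩

end Measures

section Actions

variable {G : Type*} [Group G]

/-- A continuous equivariant map from a nonempty compact space to a minimal Hausdorff `G`-space is
surjective. -/
theorem IsMinimalAction.surjective {X Y : Type*} [TopologicalSpace X]
    [CompactSpace X] [MulAction G X] [TopologicalSpace Y] [T2Space Y] [MulAction G Y]
    [Nonempty X] (hY : IsMinimalAction G Y) {f : X → Y} (hf : Continuous f)
    (hequiv : ∀ (g : G) x, f (g • x) = g • f x) : Function.Surjective f := by
  obtain ⟨x⟩ := ‹Nonempty X›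
  have hdense : DenseRange f := (hY (f x)).mono (by
    rintro _ ⟨g, rfl⟩
    exact ⟨g • x, hequiv g x⟩)
  exact range_eq_univ.1 ((isCompact_range hf).isClosed.closure_eq ▸ hdense.closure_eq)

/-- The homeomorphism given by a group element, as a continuous map. -/
def smulMap (X : Type*) [TopologicalSpace X] [MulAction G X] [ContinuousConstSMul G X] (g : G) :
    C(X, X) :=
  ⟨fun x => g • x, continuous_const_smul g⟩

variable {X : Type*} [TopologicalSpace X] [MulAction G X] [ContinuousConstSMul G X]
  [CompactSpace X] [T2Space X]

/-- Strong proximality phrased in terms of states. -/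
theorem isStronglyProximal_iff_stateSpace [MeasurableSpace X] [BorelSpace X] :
    IsStronglyProximal G X ↔ ∀ φ ∈ stateSpace X, ∃ x : X,
      evalState x ∈ closure (range fun g : G => pushState (smulMap X g) φ) := by
  have key : ∀ (μ : ProbabilityMeasure X) (x : X),
      diracProb x ∈ closure {ν | ∃ g : G, ν = pushforwardProb g μ} ↔
        evalState x ∈ closure (range fun g : G => pushState (smulMap X g) (integralState μ)) := by
    intro μ x
    rw [isInducing_integralState.closure_eq_preimage_closure_image, mem_preimage,
      integralState_diracProb]
    have hpush : ∀ g : G, integralState (pushforwardProb g μ) =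
        pushState (smulMap X g) (integralState μ) := fun g => funext fun f =>
      integral_map_of_stronglyMeasurable (continuous_const_smul g).measurable
        f.continuous.stronglyMeasurable
    have : integralState '' {ν | ∃ g : G, ν = pushforwardProb g μ} =
        range fun g : G => pushState (smulMap X g) (integralState μ) := by
      ext ψ
      simp [← hpush, eq_comm]
    rw [this]
  refine ⟨fun h φ hφ => ?_, fun h μ => ?_⟩
  · obtain ⟨μ, rfl⟩ := exists_integralState_eq hφ
    exact (h μ).imp fun x => (key μ x).1
  · exact (h _ (integralState_mem_stateSpace μ)).imp fun x => (key μ x).2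

/-- A compact Hausdorff `G`-space with a point-separating family of equivariant maps to strongly
proximal `G`-spaces is strongly proximal. -/
theorem IsStronglyProximal.of_separating [MeasurableSpace X] [BorelSpace X]
    {ι : Type*} {W : ι → Type*} [∀ i, TopologicalSpace (W i)] [∀ i, MeasurableSpace (W i)]
    [∀ i, BorelSpace (W i)] [∀ i, MulAction G (W i)] [∀ i, ContinuousConstSMul G (W i)]
    [∀ i, CompactSpace (W i)] [∀ i, T2Space (W i)] (hW : ∀ i, IsStronglyProximal G (W i))
    (p : ∀ i, C(X, W i)) (hequiv : ∀ i (g : G) x, p i (g • x) = g • p i x)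
    (hp : ∀ x x', (∀ i, p i x = p i x') → x = x') : IsStronglyProximal G X := by
  refine isStronglyProximal_iff_stateSpace.2 fun φ hφ => ?_
  let T : G → (C(X, ℝ) → ℝ) → C(X, ℝ) → ℝ := fun g => pushState (smulMap X g)
  have hTmul : ∀ g h ψ, T g (T h ψ) = T (g * h) ψ := fun g h ψ => by
    simp only [T, ← pushState_comp]
    congr 1
    ext x
    exact (mul_smul g h x).symm
  have hTp : ∀ g i ψ, pushState (p i) (T g ψ) = pushState (smulMap (W i) g) (pushState (p i) ψ) :=
    fun g i ψ => by
      simp only [T, ← pushState_comp]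
      congr 1
      ext x
      exact hequiv i g x
  let S : Set (C(X, ℝ) → ℝ) := closure (range fun g => T g φ)
  have hSK : S ⊆ stateSpace X := closure_minimal
    (range_subset_iff.2 fun g => pushState_mem_stateSpace _ hφ) isClosed_stateSpace
  have hSinv : ∀ g, MapsTo (T g) S S := fun g => by
    refine MapsTo.closure ?_ (continuous_pushState _)
    rintro _ ⟨h, rfl⟩
    exact ⟨g * h, (hTmul g h φ).symm⟩
  obtain ⟨M, hMS, hMc, ⟨ψ, hψ⟩, hMinv, hMmin⟩ := exists_minimal_closed_invariant T
    (isCompact_stateSpace.of_isClosed_subset isClosed_closure hSK) isClosed_closure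
    ⟨_, subset_closure (mem_range_self 1)⟩ hSinv
  have hMcpt : IsCompact M := isCompact_stateSpace.of_isClosed_subset hMc (hMS.trans hSK)
  have hmarg : ∀ i, ∃ y, pushState (p i) ψ = evalState y := by
    intro i
    let N : Set (C(X, ℝ) → ℝ) := M ∩ pushState (p i) ⁻¹' range evalState
    have hNc : IsClosed N := hMc.inter
      ((isCompact_range continuous_evalState).isClosed.preimage (continuous_pushState _))
    have hNne : N.Nonempty := by
      obtain ⟨y, hy⟩ := isStronglyProximal_iff_stateSpace.1 (hW i) _
        (pushState_mem_stateSpace (p i) (hSK (hMS hψ)))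
      have hsub : closure (range fun g : G => pushState (smulMap (W i) g) (pushState (p i) ψ)) ⊆
          pushState (p i) '' M :=
        closure_minimal (range_subset_iff.2 fun g => ⟨T g ψ, hMinv g hψ, hTp g i ψ⟩)
          (hMcpt.image (continuous_pushState _)).isClosed
      obtain ⟨χ, hχ, hχy⟩ := hsub hy
      exact ⟨χ, hχ, y, hχy.symm⟩
    have hNinv : ∀ g, MapsTo (T g) N N := fun g χ hχ => by
      obtain ⟨hχM, y, hy⟩ := hχ
      refine ⟨hMinv g hχM, g • y, ?_⟩
      rw [hTp, ← hy]
      rfl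
    have hψN : ψ ∈ N := hMmin N inter_subset_left hNc hNne hNinv ▸ hψ
    obtain ⟨y, hy⟩ := hψN.2
    exact ⟨y, hy.symm⟩
  obtain ⟨x, rfl⟩ := stateSpace.exists_eq_evalState p hp (hSK (hMS hψ)) hmarg
  exact ⟨x, hMS hψ⟩

end Actions

namespace GBoundary

variable {G : Type u} [Group G]

/-- The extension to ultrafilters of the orbit map of a point of a boundary. -/
noncomputable def orbitExtend (Y : GBoundary G) (y : Y.carrier) : Ultrafilter G → Y.carrier :=
  Ultrafilter.extend fun g => g • y

theorem continuous_orbitExtend (Y : GBoundary G) (y : Y.carrier) : Continuous (Y.orbitExtend y) :=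
  continuous_ultrafilter_extend _

theorem orbitExtend_pure (Y : GBoundary G) (y : Y.carrier) (g : G) :
    Y.orbitExtend y (pure g) = g • y :=
  ultrafilter_extend_pure _ g

theorem surjective_orbitExtend (Y : GBoundary G) (y : Y.carrier) :
    Function.Surjective (Y.orbitExtend y) := by
  have hdense : DenseRange (Y.orbitExtend y) := (Y.minimal y).mono (by
    rintro _ ⟨g, rfl⟩
    exact ⟨pure g, Y.orbitExtend_pure y g⟩)
  exact range_eq_univ.1
    ((isCompact_range (Y.continuous_orbitExtend y)).isClosed.closure_eq ▸ hdense.closure_eq)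

/-- Boundaries whose orbit maps have the same extension kernel admit an equivariant map. -/
theorem exists_equivariant_of_ker_eq (Y Y' : GBoundary G) (y : Y.carrier) (y' : Y'.carrier)
    (h : Setoid.ker (Y.orbitExtend y) = Setoid.ker (Y'.orbitExtend y')) :
    ∃ f : Y.carrier → Y'.carrier, Continuous f ∧ ∀ (g : G) x, f (g • x) = g • f x := by
  let s := Function.surjInv (Y.surjective_orbitExtend y)
  have hf : ∀ ξ, Y'.orbitExtend y' (s (Y.orbitExtend y ξ)) = Y'.orbitExtend y' ξ := fun ξ => by
    have : Setoid.ker (Y.orbitExtend y) (s (Y.orbitExtend y ξ)) ξ :=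
      Function.surjInv_eq (Y.surjective_orbitExtend y) _
    rwa [h] at this
  have hcont : Continuous (Y'.orbitExtend y' ∘ s) := by
    have hq : IsQuotientMap (Y.orbitExtend y) :=
      IsQuotientMap.of_surjective_continuous (Y.surjective_orbitExtend y)
        (Y.continuous_orbitExtend y)
    rw [hq.continuous_iff]
    exact (Y'.continuous_orbitExtend y').congr fun ξ => (hf ξ).symm
  refine ⟨_, hcont, fun g => congrFun ?_⟩
  refine Continuous.ext_on (Y.minimal y) (hcont.comp (continuous_const_smul g))
    (hcont.const_smul g) ?_
  have horb : ∀ k : G, (Y'.orbitExtend y' ∘ s) (k • y) = k • y' := fun k => by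
    rw [← Y.orbitExtend_pure, Function.comp_apply, hf, Y'.orbitExtend_pure]
  rintro _ ⟨k, rfl⟩
  change (Y'.orbitExtend y' ∘ s) (g • k • y) = g • (Y'.orbitExtend y' ∘ s) (k • y)
  rw [smul_smul, horb, horb, mul_smul]

/-- Any small family of boundaries is dominated by a single boundary. -/
theorem exists_dominating {ι : Type u} (Y : ι → GBoundary G) :
    ∃ F : GBoundary G, ∀ i, ∃ f : F.carrier → (Y i).carrier,
      Continuous f ∧ ∀ (g : G) x, f (g • x) = g • f x := by
  let P := ∀ i, (Y i).carrier
  obtain ⟨M, -, hMc, hMne, hMinv, hMmin⟩ := exists_minimal_closed_invariant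
    (fun (g : G) (x : P) => g • x) isCompact_univ isClosed_univ univ_nonempty
    fun g => mapsTo_univ _ _
  let act : MulAction G M :=
    { smul := fun g x => ⟨g • x.1, hMinv g x.2⟩
      one_smul := fun x => Subtype.ext (one_smul G x.1)
      mul_smul := fun g h x => Subtype.ext (mul_smul g h x.1) }
  have hsmul : ∀ (g : G) (x : M), (g • x : M).1 = g • x.1 := fun _ _ => rfl
  have hcont : ContinuousConstSMul G M :=
    ⟨fun g => (continuous_subtype_val.const_smul g).subtype_mk _⟩
  have hcpt : CompactSpace M := isCompact_iff_compactSpace.1 hMc.isCompact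
  have hne : Nonempty M := hMne.to_subtype
  let meas : MeasurableSpace M := _root_.borel M
  have hborel : BorelSpace M := ⟨rfl⟩
  have hmin : IsMinimalAction G M := by
    intro x
    have horb : closure (MulAction.orbit G x.1) = M := by
      refine hMmin _ (closure_minimal ?_ hMc) isClosed_closure
        ⟨_, subset_closure (MulAction.mem_orbit_self _)⟩ fun g => ?_
      · rintro _ ⟨g, rfl⟩
        exact hMinv g x.2
      · refine MapsTo.closure ?_ (continuous_const_smul g)
        rintro _ ⟨k, rfl⟩
        exact ⟨g * k, mul_smul g k x.1⟩
    rw [Subtype.dense_iff]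
    have himg : ((↑) : M → P) '' MulAction.orbit G x = MulAction.orbit G x.1 := by
      rw [MulAction.orbit, ← range_comp]
      rfl
    rw [himg, horb]
  let p : ∀ i, C(M, (Y i).carrier) := fun i =>
    ⟨fun x => x.1 i, (continuous_apply i).comp continuous_subtype_val⟩
  have hprox : IsStronglyProximal G M :=
    .of_separating (fun i => (Y i).stronglyProximal) p (fun _ _ _ => rfl)
      fun x x' h => Subtype.ext (funext h)
  exact ⟨{ carrier := M, minimal := hmin, stronglyProximal := hprox },
    fun i => ⟨p i, (p i).continuous, fun _ _ => rfl⟩⟩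

end GBoundary

/-- There exists a universal `G`-boundary (the Furstenberg boundary of `G`): a
`G`-boundary such that every `G`-boundary is its image under a continuous `G`-equivariant
surjection. -/
theorem exists_universal_boundary (G : Type u) [Group G] :
    ∃ F : GBoundary G, ∀ Y : GBoundary G,
      ∃ f : F.carrier → Y.carrier,
        Continuous f ∧ (∀ (g : G) (x : F.carrier), f (g • x) = g • f x) ∧
        Function.Surjective f := by
  let I : Type u := {r : Setoid (Ultrafilter G) //
    ∃ (Y : GBoundary G) (y : Y.carrier), Setoid.ker (Y.orbitExtend y) = r}
  choose B b hb using fun r : I => r.2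
  obtain ⟨F, hF⟩ := GBoundary.exists_dominating B
  refine ⟨F, fun Y => ?_⟩
  obtain ⟨y⟩ := Y.nonempty
  let r : I := ⟨Setoid.ker (Y.orbitExtend y), Y, y, rfl⟩
  obtain ⟨q, hq, hqG⟩ := hF r
  obtain ⟨h, hh, hhG⟩ := GBoundary.exists_equivariant_of_ker_eq (B r) Y (b r) y (hb r)
  have hequiv : ∀ (g : G) x, (h ∘ q) (g • x) = g • (h ∘ q) x := fun g x => by
    simp only [Function.comp_apply, hqG, hhG]
  exact ⟨h ∘ q, hh.comp hq, hequiv, Y.minimal.surjective (hh.comp hq) hequiv⟩
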